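/- arXiv:0911.1300 — 2 statements merged into one kernel-verified Lean document; each statement's English description precedes it below -/
import Mathlib

section
/- Let G be a groupoid, Γ a commutative group with neutral element 1, and δ : Γ → (G → G), ε ↦ δ_ε, a family of maps satisfying α(δ_ε g) = α(g), δ_ε(δ_μ g) = δ_{εμ} g, δ_1 = id, and δ_ε(e(x)) = e(x) for every object x. For arrows g, h with α(g) = α(h) define the dilatation δ_ε^h g = δ_ε(gh⁻¹)h, the approximate sum Σ_ε(g, h) = δ_{ε⁻¹}(δ_ε(g·(δ_ε h)⁻¹)·δ_ε h), and for u, g, h with α(u) = α(g) = α(h) the three-argument approximate sum Σ_ε^u(g, h) = δ_{ε⁻¹}^u(δ_ε^{δ_ε^u g} h). Then for all ε ∈ Γ and all u, g, h with α(u) = α(g) = α(h): Σ_ε(hu⁻¹, gu⁻¹) = Σ_ε^u(g, h)·u⁻¹. -/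
/-- A groupoid given by its set of objects `X` and set of arrows `G`, with
source `src`, target `tgt`, identity section `unit`, a (total) composition
`comp` whose value is only meaningful when `src g = tgt h`, and inversion
`inv`. -/
structure GroupoidStr (X : Type*) (G : Type*) where
  src : G → X
  tgt : G → X
  unit : X → G
  comp : G → G → G
  inv : G → G
  src_unit : ∀ x, src (unit x) = x
  tgt_unit : ∀ x, tgt (unit x) = x
  src_comp : ∀ g h, src g = tgt h → src (comp g h) = src h
  tgt_comp : ∀ g h, src g = tgt h → tgt (comp g h) = tgt g
  comp_assoc : ∀ g h k, src g = tgt h → src h = tgt k →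
    comp (comp g h) k = comp g (comp h k)
  unit_comp : ∀ g, comp (unit (tgt g)) g = g
  comp_unit : ∀ g, comp g (unit (src g)) = g
  src_inv : ∀ g, src (inv g) = tgt g
  tgt_inv : ∀ g, tgt (inv g) = src g
  inv_comp : ∀ g, comp (inv g) g = unit (src g)
  comp_inv : ∀ g, comp g (inv g) = unit (tgt g)

/-- `d` is a norm on the groupoid `S`. -/
structure IsGroupoidNorm {X G : Type*} (S : GroupoidStr X G) (d : G → ℝ) : Prop where
  nonneg : ∀ g, 0 ≤ d g
  eq_zero_iff : ∀ g, (d g = 0 ↔ ∃ x, g = S.unit x)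
  comp_le : ∀ g h, S.src g = S.tgt h → d (S.comp g h) ≤ d g + d h
  inv_eq : ∀ g, d (S.inv g) = d g

/-- The dilatation based at `h`: `δ_ε^h g = δ_ε (g h⁻¹) h`. -/
def dilat {X G Γ : Type*} (S : GroupoidStr X G) (δ : Γ → G → G)
    (ε : Γ) (h g : G) : G :=
  S.comp (δ ε (S.comp g (S.inv h))) h

/-- The approximate sum `Σ_ε (g, h) = δ_{ε⁻¹} (δ_ε (g (δ_ε h)⁻¹) · δ_ε h)`. -/
def SigmaE {X G Γ : Type*} [Group Γ] (S : GroupoidStr X G) (δ : Γ → G → G)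
    (ε : Γ) (g h : G) : G :=
  δ ε⁻¹ (S.comp (δ ε (S.comp g (S.inv (δ ε h)))) (δ ε h))

namespace GroupoidStr

variable {X G : Type*} (S : GroupoidStr X G)

theorem comp_inv_cancel_right {g h : G} (hgh : S.src g = S.tgt h) :
    S.comp (S.comp g h) (S.inv h) = g := by
  rw [S.comp_assoc g h _ hgh (S.tgt_inv h).symm, S.comp_inv, ← hgh, S.comp_unit]

theorem eq_inv_of_comp_eq_unit {g h : G} (hgh : S.src g = S.tgt h)
    (h_unit : S.comp g h = S.unit (S.tgt g)) : h = S.inv g := by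
  have key := S.comp_assoc (S.inv g) g h (S.src_inv g) hgh
  rwa [S.inv_comp, hgh, S.unit_comp, h_unit, ← S.src_inv, S.comp_unit] at key

theorem inv_comp_rev {g h : G} (hgh : S.src g = S.tgt h) :
    S.inv (S.comp g h) = S.comp (S.inv h) (S.inv g) := by
  have hinv : S.src (S.inv h) = S.tgt (S.inv g) := by rw [S.src_inv, S.tgt_inv, hgh]
  have hmid : S.src (S.comp g h) = S.tgt (S.inv h) := by rw [S.src_comp g h hgh, S.tgt_inv]
  refine (S.eq_inv_of_comp_eq_unit ?_ ?_).symm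
  · rw [S.tgt_comp _ _ hinv, hmid]
  · rw [← S.comp_assoc _ _ _ hmid hinv, S.comp_inv_cancel_right hgh, S.comp_inv,
      S.tgt_comp g h hgh]

end GroupoidStr

/-- For a groupoid `S` with a family of maps `δ_ε` (indexed by a commutative
group `Γ`) fixing sources, forming an action and fixing identity arrows, the
approximate sum functions satisfy
`Σ_ε (h u⁻¹, g u⁻¹) = Σ_ε^u (g, h) · u⁻¹`, where
`Σ_ε^u (g, h) = δ_{ε⁻¹}^u (δ_ε^{δ_ε^u g} h)`. -/
theorem approximate_sum_translation {X G Γ : Type*} [CommGroup Γ]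
    (S : GroupoidStr X G) (δ : Γ → G → G)
    (hsrc : ∀ (ε : Γ) (g : G), S.src (δ ε g) = S.src g)
    (haction : ∀ (ε μ : Γ) (g : G), δ ε (δ μ g) = δ (ε * μ) g)
    (hone : ∀ g : G, δ 1 g = g)
    (hunit : ∀ (ε : Γ) (x : X), δ ε (S.unit x) = S.unit x)
    (ε : Γ) (u g h : G)
    (hg : S.src g = S.src u) (hh : S.src h = S.src u) :
    SigmaE S δ ε (S.comp h (S.inv u)) (S.comp g (S.inv u)) =
      S.comp (dilat S δ ε⁻¹ u (dilat S δ ε (dilat S δ ε u g) h)) (S.inv u) := by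
  have src_mul_inv : ∀ k : G, S.src k = S.src u → S.src (S.comp k (S.inv u)) = S.tgt u :=
    fun k hk => by rw [S.src_comp _ _ (hk.trans (S.tgt_inv u).symm), S.src_inv]
  unfold SigmaE dilat
  have hA : S.src (δ ε (S.comp g (S.inv u))) = S.tgt u := by rw [hsrc, src_mul_inv g hg]
  generalize δ ε (S.comp g (S.inv u)) = A at hA ⊢
  have hhu : S.src h = S.tgt (S.inv u) := by rw [S.tgt_inv, hh]
  have huA : S.src (S.inv u) = S.tgt (S.inv A) := by rw [S.src_inv, S.tgt_inv, hA]
  rw [S.inv_comp_rev hA, ← S.comp_assoc _ _ _ hhu huA]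
  have hB : S.src (δ ε (S.comp (S.comp h (S.inv u)) (S.inv A))) = S.tgt A := by
    rw [hsrc, S.src_comp _ _ (by rw [src_mul_inv h hh, S.tgt_inv, hA]), S.src_inv]
  generalize δ ε (S.comp (S.comp h (S.inv u)) (S.inv A)) = B at hB ⊢
  have hBA : S.src (S.comp B A) = S.tgt u := by rw [S.src_comp B A hB, hA]
  rw [← S.comp_assoc B A u hB hA, S.comp_inv_cancel_right hBA,
    S.comp_inv_cancel_right (by rw [hsrc, hBA])]
end

section
/- Let G be a groupoid, Γ a commutative group with neutral element 1, and δ : Γ → (G → G), ε ↦ δ_ε, a family of maps satisfying α(δ_ε g) = α(g), δ_ε(δ_μ g) = δ_{εμ} g, δ_1 = id, and δ_ε(e(x)) = e(x) for every object x. Fix an object x and, on the fiber α⁻¹(x) = {g : α(g) = x}, define for each ε ∈ Γ the operations g ∘_ε h = δ_ε(hg⁻¹)g and g •_ε h = g ∘_{ε⁻¹} h. Then for every ε, μ ∈ Γ and all g, h ∈ α⁻¹(x): (P2) g ∘_ε g = g; (P1) g ∘_ε (g •_ε h) = h and g •_ε (g ∘_ε h) = h; and the Γ-irq law g ∘_ε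 (g ∘_μ h) = g ∘_{εμ} h holds. In particular (α⁻¹(x), ∘_ε, •_ε) is an idempotent right quasigroup for every ε ∈ Γ. -/
/-- The dilatation-induced operation on a fiber: `g ∘_ε h = δ_ε (h g⁻¹) g`. -/
def fiberOp {X G Γ : Type*} (S : GroupoidStr X G) (δ : Γ → G → G)
    (ε : Γ) (g h : G) : G :=
  S.comp (δ ε (S.comp h (S.inv g))) g

namespace GroupoidStr

theorem comp_inv_cancel_right_s18 {X G : Type*} (S : GroupoidStr X G) {k g : G}
    (hkg : S.src k = S.tgt g) : S.comp (S.comp k g) (S.inv g) = k := by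
  rw [S.comp_assoc _ _ _ hkg (S.tgt_inv g).symm, S.comp_inv, ← hkg, S.comp_unit]

theorem inv_comp_cancel_right {X G : Type*} (S : GroupoidStr X G) {h g : G}
    (hhg : S.src h = S.src g) : S.comp (S.comp h (S.inv g)) g = h := by
  rw [S.comp_assoc _ _ _ (hhg.trans (S.tgt_inv g).symm) (S.src_inv g), S.inv_comp, ← hhg,
    S.comp_unit]

theorem src_comp_inv {X G : Type*} (S : GroupoidStr X G) {h g : G}
    (hhg : S.src h = S.src g) : S.src (S.comp h (S.inv g)) = S.tgt g := by
  rw [S.src_comp _ _ (hhg.trans (S.tgt_inv g).symm), S.src_inv]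

end GroupoidStr

theorem fiberOp_fiberOp {X G Γ : Type*} [Mul Γ] (S : GroupoidStr X G) (δ : Γ → G → G)
    (hsrc : ∀ (ε : Γ) (g : G), S.src (δ ε g) = S.src g)
    (haction : ∀ (ε μ : Γ) (g : G), δ ε (δ μ g) = δ (ε * μ) g)
    (ε μ : Γ) {g h : G} (hhg : S.src h = S.src g) :
    fiberOp S δ ε g (fiberOp S δ μ g h) = fiberOp S δ (ε * μ) g h := by
  unfold fiberOp
  rw [S.comp_inv_cancel_right_s18 ((hsrc _ _).trans (S.src_comp_inv hhg)), haction]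

theorem fiberOp_one {X G Γ : Type*} [One Γ] (S : GroupoidStr X G) (δ : Γ → G → G)
    (hone : ∀ g : G, δ 1 g = g) {g h : G} (hhg : S.src h = S.src g) :
    fiberOp S δ 1 g h = h := by
  rw [fiberOp, hone, S.inv_comp_cancel_right hhg]

theorem fiberOp_self {X G Γ : Type*} (S : GroupoidStr X G) (δ : Γ → G → G)
    (hunit : ∀ (ε : Γ) (x : X), δ ε (S.unit x) = S.unit x) (ε : Γ) (g : G) :
    fiberOp S δ ε g g = g := by
  rw [fiberOp, S.comp_inv, hunit, S.unit_comp]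

/-- Let `S` be a groupoid with a family of maps `δ_ε` (indexed by a commutative
group `Γ`) fixing sources, forming an action of `Γ` and fixing identity arrows.
On the fiber `α⁻¹(x)` define `g ∘_ε h = δ_ε (h g⁻¹) g` and `g •_ε h = g ∘_{ε⁻¹} h`.
Then: (P2) `g ∘_ε g = g`; (P1) `g ∘_ε (g •_ε h) = h` and `g •_ε (g ∘_ε h) = h`;
and the `Γ`-irq law `g ∘_ε (g ∘_μ h) = g ∘_{εμ} h` holds. In particular
`(α⁻¹(x), ∘_ε, •_ε)` is an idempotent right quasigroup for every `ε`. -/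
theorem fiber_gamma_irq {X G Γ : Type*} [CommGroup Γ]
    (S : GroupoidStr X G) (δ : Γ → G → G)
    (hsrc : ∀ (ε : Γ) (g : G), S.src (δ ε g) = S.src g)
    (haction : ∀ (ε μ : Γ) (g : G), δ ε (δ μ g) = δ (ε * μ) g)
    (hone : ∀ g : G, δ 1 g = g)
    (hunit : ∀ (ε : Γ) (x : X), δ ε (S.unit x) = S.unit x)
    (x : X) (ε μ : Γ) (g h : G)
    (hg : S.src g = x) (hh : S.src h = x) :
    fiberOp S δ ε g g = g ∧
    fiberOp S δ ε g (fiberOp S δ ε⁻¹ g h) = h ∧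
    fiberOp S δ ε⁻¹ g (fiberOp S δ ε g h) = h ∧
    fiberOp S δ ε g (fiberOp S δ μ g h) = fiberOp S δ (ε * μ) g h := by
  have hhg : S.src h = S.src g := hh.trans hg.symm
  have hcomp (a b : Γ) := fiberOp_fiberOp S δ hsrc haction a b hhg
  refine ⟨fiberOp_self S δ hunit ε g, ?_, ?_, hcomp ε μ⟩
  · rw [hcomp, mul_inv_cancel, fiberOp_one S δ hone hhg]
  · rw [hcomp, inv_mul_cancel, fiberOp_one S δ hone hhg]
end
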